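/- For every dimension d ≥ 1 and every θ ∈ (0,1) there exists a constant C > 0 such that for every nonempty measurable set Ω ⊆ ℝ^d of finite width one has ρ_θ(Ω) ≤ C · w_Ω, where w_Ω := inf_{ω ∈ S^{d−1}} ( sup_{x ∈ Ω} ω·x − inf_{x ∈ Ω} ω·x ) is the width of Ω and S^{d−1} denotes the unit sphere in ℝ^d. -/

import Mathlib

open MeasureTheory
open scoped ENNReal RealInnerProductSpace

/-- The regularized inradius `ρ_θ(Ω)`: the infimum (in `ℝ≥0∞`, with `inf ∅ = ∞`) of all
`ρ > 0` such that `|Ω ∩ B_ρ(x)| ≤ θ |B_ρ(x)|` for all `x ∈ ℝ^d`. -/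
noncomputable def regInradius (d : ℕ) (θ : ℝ) (Ω : Set (EuclideanSpace ℝ (Fin d))) : ℝ≥0∞ :=
  sInf (ENNReal.ofReal ''
    {ρ : ℝ | 0 < ρ ∧ ∀ x : EuclideanSpace ℝ (Fin d),
      volume (Ω ∩ Metric.ball x ρ) ≤ ENNReal.ofReal θ * volume (Metric.ball x ρ)})

/-- The set of admissible widths of `Ω`: `w ≥ 0` belongs to it iff there is a unit direction
`ω` in which `Ω` is contained in a slab `{x : a ≤ ω·x ≤ a + w}`.  The width
`w_Ω = inf_{ω ∈ S^{d-1}} (sup_{x ∈ Ω} ω·x − inf_{x ∈ Ω} ω·x)` is the infimum of this set,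
and `Ω` has finite width iff this set is nonempty. -/
def widthSet (d : ℕ) (Ω : Set (EuclideanSpace ℝ (Fin d))) : Set ℝ :=
  {w : ℝ | 0 ≤ w ∧ ∃ ω : EuclideanSpace ℝ (Fin d), ‖ω‖ = 1 ∧
    ∃ a : ℝ, ∀ x ∈ Ω, a ≤ ⟪ω, x⟫ ∧ ⟪ω, x⟫ ≤ a + w}
lemma slab_ball_bound (d : ℕ) (hd : 1 ≤ d) (θ : ℝ) (N : ℕ) (hN : 0 < N) (hNθ : 3 ≤ θ * N)
    (Ω : Set (EuclideanSpace ℝ (Fin d))) (hΩ : MeasurableSet Ω) (w v : ℝ)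
    (hw : w ∈ widthSet d Ω) (hwv : w < v) (x : EuclideanSpace ℝ (Fin d)) :
    volume (Ω ∩ Metric.ball x (N * d * v)) ≤
      ENNReal.ofReal θ * volume (Metric.ball x (N * d * v)) := by
  obtain ⟨hw0, ω, hω, a, ha⟩ := hw
  have hv : 0 < v := hw0.trans_lt hwv
  have hd' : (0 : ℝ) < d := by exact_mod_cast hd
  have hN' : (0 : ℝ) < N := by exact_mod_cast hN
  have hωω : ⟪ω, ω⟫ = (1 : ℝ) := by rw [real_inner_self_eq_norm_sq, hω]; norm_num
  set A := Ω ∩ Metric.ball x (N * d * v) with hA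
  have hAm : MeasurableSet A := hΩ.inter measurableSet_ball
  let T : ℕ → Set (EuclideanSpace ℝ (Fin d)) := fun k => (fun y => y + (-((k : ℝ) * v)) • ω) ⁻¹' A
  have hTm : ∀ k, MeasurableSet (T k) := fun k => (measurable_add_const _) hAm
  have hTv : ∀ k, volume (T k) = volume A := fun k => measure_preimage_add_right _ _ _
  have hdis : ∀ j k : ℕ, j < k → Disjoint (T j) (T k) := by
    intro j k hjk
    rw [Set.disjoint_left]
    intro y hj hk
    have h1 := ha _ hj.1
    have h2 := ha _ hk.1
    simp only [inner_add_right, inner_smul_right, hωω] at h1 h2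
    have h3 : (j : ℝ) + 1 ≤ k := by exact_mod_cast hjk
    nlinarith
  have hsub : (⋃ k ∈ Finset.range N, T k) ⊆ Metric.ball x ((1 + 1 / (d : ℝ)) * (N * d * v)) := by
    intro y hy
    simp only [Set.mem_iUnion, Finset.mem_range] at hy
    obtain ⟨k, hk, hy⟩ := hy
    have h1 : dist (y + (-((k : ℝ) * v)) • ω) x < N * d * v := hy.2
    have h2 : dist y (y + (-((k : ℝ) * v)) • ω) = k * v := by
      rw [dist_self_add_right, norm_smul, hω, norm_neg, mul_one, Real.norm_of_nonneg (by positivity)]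
    have h3 : (k : ℝ) * v ≤ N * v := by gcongr
    have h4 : (1 + 1 / (d : ℝ)) * (N * d * v) = N * d * v + N * v := by field_simp
    rw [Metric.mem_ball, h4]
    linarith [dist_triangle y (y + (-((k : ℝ) * v)) • ω) x]
  have hsum : (N : ℝ≥0∞) * volume A = volume (⋃ k ∈ Finset.range N, T k) := by
    rw [measure_biUnion_finset _ (fun k _ => hTm k)]
    · simp [hTv]
    · intro j _ k _ hjk
      rcases lt_or_gt_of_ne hjk with h | h
      · exact hdis j k h
      · exact (hdis k j h).symm
  have hpow : (1 + 1 / (d : ℝ)) ^ d ≤ 3 := by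
    have h1 : 1 + 1 / (d : ℝ) ≤ Real.exp (1 / d) := by linarith [Real.add_one_le_exp (1 / (d : ℝ))]
    calc (1 + 1 / (d : ℝ)) ^ d ≤ Real.exp (1 / d) ^ d := by gcongr
      _ = Real.exp 1 := by rw [← Real.exp_nat_mul]; congr 1; field_simp
      _ ≤ 3 := by linarith [Real.exp_one_lt_d9]
  have hball : volume (Metric.ball x ((1 + 1 / (d : ℝ)) * (N * d * v))) ≤
      ENNReal.ofReal 3 * volume (Metric.ball x (N * d * v)) := by
    rw [Measure.addHaar_ball_mul_of_pos _ _ (by positivity), Measure.addHaar_ball_center _ x,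
      finrank_euclideanSpace_fin]
    gcongr
  have hθ0 : 0 ≤ θ := by
    by_contra h
    nlinarith
  have key : (N : ℝ≥0∞) * volume A ≤
      (N : ℝ≥0∞) * (ENNReal.ofReal θ * volume (Metric.ball x (N * d * v))) := by
    rw [hsum, ← mul_assoc]
    refine (measure_mono hsub).trans (hball.trans ?_)
    gcongr
    rw [← ENNReal.ofReal_natCast, ← ENNReal.ofReal_mul hN'.le]
    exact ENNReal.ofReal_le_ofReal (by linarith)
  exact (ENNReal.mul_le_mul_iff_right (by exact_mod_cast hN.ne') (ENNReal.natCast_ne_top N)).1 key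

/-- For every `d ≥ 1` and `θ ∈ (0,1)` there is `C > 0` such that every nonempty measurable
set `Ω ⊆ ℝ^d` of finite width satisfies `ρ_θ(Ω) ≤ C w_Ω`. -/
theorem regInradius_le_width
    (d : ℕ) (hd : 1 ≤ d) (θ : ℝ) (hθ : θ ∈ Set.Ioo (0 : ℝ) 1) :
    ∃ C : ℝ, 0 < C ∧
      ∀ Ω : Set (EuclideanSpace ℝ (Fin d)), MeasurableSet Ω → Ω.Nonempty →
        (widthSet d Ω).Nonempty →
        regInradius d θ Ω ≤ ENNReal.ofReal (C * sInf (widthSet d Ω)) := by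
  obtain ⟨hθ0, hθ1⟩ := hθ
  obtain ⟨N, hN⟩ := exists_nat_ge (3 / θ)
  have hNθ : 3 ≤ θ * N := by
    rw [div_le_iff₀ hθ0] at hN
    linarith
  have hN' : (0 : ℝ) < N := by
    by_contra h
    nlinarith
  have hN0 : 0 < N := by exact_mod_cast hN'
  have hd' : (0 : ℝ) < d := by exact_mod_cast hd
  refine ⟨N * d, by positivity, fun Ω hΩ _ hne => ?_⟩
  have hbdd : BddBelow (widthSet d Ω) := ⟨0, fun w hw => hw.1⟩
  have h : ∀ v, sInf (widthSet d Ω) < v → regInradius d θ Ω ≤ ENNReal.ofReal (N * d * v) := by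
    intro v hv
    obtain ⟨w, hw, hwv⟩ := (csInf_lt_iff hbdd hne).1 hv
    have hv0 : 0 < v := hw.1.trans_lt hwv
    exact sInf_le ⟨_, ⟨by positivity, slab_ball_bound d hd θ N hN0 hNθ Ω hΩ w v hw hwv⟩, rfl⟩
  have hc : Continuous fun v : ℝ => ENNReal.ofReal (N * d * v) :=
    ENNReal.continuous_ofReal.comp (by fun_prop)
  exact ge_of_tendsto ((hc.tendsto (sInf (widthSet d Ω))).mono_left nhdsWithin_le_nhds)
    (Filter.eventually_of_mem (self_mem_nhdsWithin (s := Set.Ioi _)) h)
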